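/- Let v be a smooth solution of ∂²_t v − Δv = 0 on ℝ₊ × ℝ³, let K ≥ 1, and define the modified local energy e(s) := (1/2)∫_{ℝ³} φ_{t−s,x}(y)(|∂_t v(s,y)|² + |∇v(s,y)|² + K|v(s,y)|²) dy, where φ_{t−s,x}(y) = ψ(|y−x| − 2(t−s)) with ψ the standard piecewise linear cutoff. Then for a.e. s ∈ [0,t], d/ds e(s) ≤ −(K/2)∫_{ℝ³} χ_{{|y−x|−2(t−s)∈[0,1]}} |v(s,y)|² dy + K·e(s). -/

import Mathlib

open MeasureTheory

/-- The piecewise-linear cutoff function. -/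
noncomputable def psiCutoff (r : ℝ) : ℝ :=
  if r ≤ 0 then 1 else if r ≤ 1 then 1 - r else 0

/-- The (flat) Laplacian of a function on `ℝ³`. -/
noncomputable def laplacian3 (f : EuclideanSpace ℝ (Fin 3) → ℝ)
    (y : EuclideanSpace ℝ (Fin 3)) : ℝ :=
  ∑ i : Fin 3,
    fderiv ℝ (fun z => fderiv ℝ f z (EuclideanSpace.single i 1)) y
      (EuclideanSpace.single i 1)

/-- The Tartar-type local energy with zeroth-order term of strength `K`,
built from the moving bump with propagation speed `2`. -/
noncomputable def tartarEnergy (v : ℝ → EuclideanSpace ℝ (Fin 3) → ℝ)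
    (x : EuclideanSpace ℝ (Fin 3)) (t K s : ℝ) : ℝ :=
  (1 / 2 : ℝ) * ∫ y,
    psiCutoff (‖y - x‖ - 2 * (t - s)) *
      ((deriv (fun τ => v τ y) s) ^ 2 + ‖fderiv ℝ (v s) y‖ ^ 2
        + K * (v s y) ^ 2)


/-- Shorthand for three-dimensional Euclidean space. -/
abbrev E3 : Type := EuclideanSpace ℝ (Fin 3)

/-- The annulus where the cutoff is sloped. -/
def annulus3 (x : E3) (c : ℝ) : Set E3 := {y : E3 | ‖y - x‖ - c ∈ Set.Icc (0 : ℝ) 1}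

lemma psiCutoff_eq (r : ℝ) : psiCutoff r = max 0 (min 1 (1 - r)) := by
  unfold psiCutoff
  split_ifs with h1 h2
  · rw [min_eq_left (by linarith), max_eq_right (by norm_num)]
  · rw [min_eq_right (by linarith), max_eq_right (by linarith)]
  · rw [min_eq_right (by linarith), max_eq_left (by linarith)]

lemma psiCutoff_nonneg (r : ℝ) : 0 ≤ psiCutoff r := by
  rw [psiCutoff_eq]; exact le_max_left _ _

lemma psiCutoff_le_one (r : ℝ) : psiCutoff r ≤ 1 := by
  rw [psiCutoff_eq]; exact max_le (by norm_num) (min_le_left _ _)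

lemma psiCutoff_lip : LipschitzWith 1 psiCutoff := by
  have h : LipschitzWith 1 (fun r : ℝ => max (min (1 - r) 1) 0) := by
    have h1 : LipschitzWith 1 (fun r : ℝ => 1 - r) := by
      apply LipschitzWith.of_dist_le_mul
      intro a b
      rw [Real.dist_eq, Real.dist_eq, show (1 - a) - (1 - b) = -(a - b) by ring, abs_neg]
      simp
    exact (h1.min_const 1).max_const 0
  convert h using 1
  ext r
  rw [psiCutoff_eq, max_comm, min_comm]

lemma psiCutoff_abs_sub (a b : ℝ) : |psiCutoff a - psiCutoff b| ≤ |a - b| := by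
  simpa [Real.dist_eq] using psiCutoff_lip.dist_le_mul a b

lemma psiCutoff_zero {r : ℝ} (h : 1 ≤ r) : psiCutoff r = 0 := by
  rw [psiCutoff_eq, min_eq_right (by linarith), max_eq_left (by linarith)]

/-- The derivative of the cutoff away from its two kinks. -/
lemma psiCutoff_hasDerivAt {r : ℝ} (h0 : r ≠ 0) (h1 : r ≠ 1) :
    HasDerivAt psiCutoff ((Set.Icc (0 : ℝ) 1).indicator (fun _ => (-1 : ℝ)) r) r := by
  rcases lt_or_gt_of_ne h0 with h | h
  · rw [Set.indicator_of_notMem (fun hh => by linarith [hh.1])]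
    refine (hasDerivAt_const r (1 : ℝ)).congr_of_eventuallyEq ?_
    filter_upwards [Iio_mem_nhds h] with z hz
    simp [psiCutoff, le_of_lt (show z < 0 from hz)]
  · rcases lt_or_gt_of_ne h1 with h' | h'
    · rw [Set.indicator_of_mem (show r ∈ Set.Icc (0 : ℝ) 1 from ⟨h.le, h'.le⟩)]
      refine ((hasDerivAt_id r).const_sub 1).congr_of_eventuallyEq ?_
      filter_upwards [Ioo_mem_nhds h h'] with z hz
      simp [psiCutoff, not_le.2 hz.1, hz.2.le]
    · rw [Set.indicator_of_notMem (fun hh => by linarith [hh.2])]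
      refine (hasDerivAt_const r (0 : ℝ)).congr_of_eventuallyEq ?_
      filter_upwards [Ioi_mem_nhds h'] with z hz
      exact psiCutoff_zero (le_of_lt hz)

lemma bump_lip (x : E3) (c : ℝ) : LipschitzWith 1 (fun y : E3 => psiCutoff (‖y - x‖ - c)) := by
  apply LipschitzWith.of_dist_le_mul
  intro a b
  rw [Real.dist_eq, NNReal.coe_one, one_mul, dist_eq_norm]
  refine (psiCutoff_abs_sub _ _).trans ?_
  have := abs_norm_sub_norm_le (a - x) (b - x)
  simpa using this

lemma bump_cpt (x : E3) (c : ℝ) : HasCompactSupport (fun y : E3 => psiCutoff (‖y - x‖ - c)) := by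
  apply HasCompactSupport.intro (isCompact_closedBall x (c + 1))
  intro y hy
  apply psiCutoff_zero
  rw [Metric.mem_closedBall, dist_eq_norm] at hy
  linarith

lemma annulus3_compact (x : E3) (c : ℝ) : IsCompact (annulus3 x c) := by
  apply (isCompact_closedBall x (c + 1)).of_isClosed_subset
  · exact isClosed_Icc.preimage (by fun_prop : Continuous fun y : E3 => ‖y - x‖ - c)
  · intro y hy
    rw [Metric.mem_closedBall, dist_eq_norm]
    linarith [hy.2]

lemma sphere_ae (x : E3) (r : ℝ) : ∀ᵐ y : E3, ‖y - x‖ ≠ r := by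
  have h : volume (Metric.sphere x r) = 0 := Measure.addHaar_sphere volume x r
  filter_upwards [measure_eq_zero_iff_ae_notMem.1 h] with y hy hh
  exact hy (by rw [Metric.mem_sphere, dist_eq_norm]; exact hh)

/-- Off the annulus the bump is locally constant. -/
lemma bump_lineDeriv_off (x : E3) (c : ℝ) (e : E3) {y : E3} (hy : y ∉ annulus3 x c) :
    lineDeriv ℝ (fun y : E3 => psiCutoff (‖y - x‖ - c)) y e = 0 := by
  have hcont : Continuous fun y : E3 => ‖y - x‖ - c := by fun_prop
  have hr : ‖y - x‖ - c ≠ 0 ∧ ‖y - x‖ - c ≠ 1 := by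
    constructor <;> intro h <;> apply hy <;> constructor <;> linarith
  have key : ∃ k : ℝ, (fun y : E3 => psiCutoff (‖y - x‖ - c)) =ᶠ[nhds y] fun _ => k := by
    rcases lt_or_gt_of_ne hr.1 with h | h
    · refine ⟨1, ?_⟩
      filter_upwards [hcont.continuousAt.eventually (Iio_mem_nhds h)] with z hz
      simp only [psiCutoff]; rw [if_pos (le_of_lt hz)]
    · have h' : 1 < ‖y - x‖ - c := by
        by_contra hh
        exact hy ⟨h.le, not_lt.1 hh⟩
      refine ⟨0, ?_⟩
      filter_upwards [hcont.continuousAt.eventually (Ioi_mem_nhds h')] with z hz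
      exact psiCutoff_zero (le_of_lt hz)
  obtain ⟨k, hk⟩ := key
  rw [hk.lineDeriv_eq]
  simp [lineDeriv]

lemma norm_sq_dual (L : E3 →L[ℝ] ℝ) :
    ‖L‖ ^ 2 = ∑ i : Fin 3, (L (EuclideanSpace.single i 1)) ^ 2 := by
  have h := (EuclideanSpace.basisFun (Fin 3) ℝ).sum_sq_norm_inner_left
    ((InnerProductSpace.toDual ℝ E3).symm L)
  rw [LinearIsometryEquiv.norm_map] at h
  rw [← h]
  apply Finset.sum_congr rfl
  intro i _
  rw [InnerProductSpace.toDual_symm_apply]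
  simp

/-- Integration by parts against the bump. -/
lemma bump_ibp (x : E3) (c : ℝ) (e : E3) (h : E3 → ℝ) (hh : ContDiff ℝ 1 h) :
    Integrable (fun y => lineDeriv ℝ (fun y : E3 => psiCutoff (‖y - x‖ - c)) y e * h y) ∧
    ∫ y, psiCutoff (‖y - x‖ - c) * fderiv ℝ h y e
      = - ∫ y, lineDeriv ℝ (fun y : E3 => psiCutoff (‖y - x‖ - c)) y e * h y := by
  let η : ContDiffBump x := ⟨|c| + 2, |c| + 3, by positivity, by linarith⟩
  have hη : ∀ y : E3, ‖y - x‖ - c ≤ 1 → η =ᶠ[nhds y] 1 := by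
    intro y hy
    apply η.eventuallyEq_one_of_mem_ball
    rw [Metric.mem_ball, dist_eq_norm]
    change _ < |c| + 2
    linarith [le_abs_self c]
  have hgc : ContDiff ℝ 1 (fun y => h y * η y) := hh.mul η.contDiff
  have hgs : HasCompactSupport (fun y => h y * η y) := η.hasCompactSupport.mul_left
  obtain ⟨C, hC⟩ := hgc.lipschitzWith_of_hasCompactSupport hgs (by simp)
  have e1 : ∀ y, lineDeriv ℝ (fun y : E3 => psiCutoff (‖y - x‖ - c)) y e * h y
      = lineDeriv ℝ (fun y : E3 => psiCutoff (‖y - x‖ - c)) y e * (h y * η y) := by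
    intro y
    by_cases hy : y ∈ annulus3 x c
    · rw [(hη y hy.2).eq_of_nhds]; simp
    · rw [bump_lineDeriv_off x c e hy]; simp
  have e2 : ∀ y, psiCutoff (‖y - x‖ - c) * fderiv ℝ h y e
      = lineDeriv ℝ (fun y => h y * η y) y e * psiCutoff (‖y - x‖ - c) := by
    intro y
    by_cases hy : ‖y - x‖ - c ≤ 1
    · have : (fun y => h y * η y) =ᶠ[nhds y] h := by
        filter_upwards [hη y hy] with z hz
        rw [hz]; simp
      rw [this.lineDeriv_eq,
        (hh.differentiable (by simp) y).lineDeriv_eq_fderiv, mul_comm]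
    · rw [psiCutoff_zero (not_le.1 hy).le]; simp
  constructor
  · simp_rw [e1]
    exact ((bump_lip x c).locallyIntegrable_lineDeriv e).integrable_smul_right_of_hasCompactSupport
      hgc.continuous hgs
  · simp_rw [e1, e2]
    rw [hC.integral_lineDeriv_mul_eq (bump_lip x c) (bump_cpt x c) e, ← integral_neg]
    simp_rw [lineDeriv_neg, neg_mul]

/-- Differentiation of a bump-weighted integral. -/
lemma bump_hasDerivAt (q : ℝ × E3 → ℝ) (hq : ContDiff ℝ 1 q) (x : E3) (t s : ℝ) :
    HasDerivAt (fun s => ∫ y, psiCutoff (‖y - x‖ - 2 * (t - s)) * q (s, y))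
      (∫ y, ((annulus3 x (2 * (t - s))).indicator (fun y => -2 * q (s, y)) y
        + psiCutoff (‖y - x‖ - 2 * (t - s)) * fderiv ℝ q (s, y) (1, 0))) s := by
  set R : ℝ := 2 * (t - s) + 3 with hR
  have hd : ∀ τ y, HasDerivAt (fun τ => q (τ, y)) (fderiv ℝ q (τ, y) (1, 0)) τ := by
    intro τ y
    have h1 : HasFDerivAt q (fderiv ℝ q (τ, y)) (τ, y) :=
      (hq.differentiable (by simp) (τ, y)).hasFDerivAt
    exact h1.comp_hasDerivAt τ ((hasDerivAt_id τ).prodMk (hasDerivAt_const τ y))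
  have hcq : Continuous q := hq.continuous
  have hcq' : Continuous fun z => fderiv ℝ q z (1, 0) :=
    (hq.continuous_fderiv (by simp)).clm_apply continuous_const
  have hcpt : IsCompact (Set.Icc (s - 1) (s + 1) ×ˢ Metric.closedBall x R) :=
    isCompact_Icc.prod (isCompact_closedBall x R)
  obtain ⟨M, hM⟩ := hcpt.exists_bound_of_continuousOn hcq.continuousOn
  obtain ⟨M', hM'⟩ := hcpt.exists_bound_of_continuousOn hcq'.continuousOn
  have hcs : ∀ s', Continuous fun y : E3 => psiCutoff (‖y - x‖ - 2 * (t - s')) * q (s', y) :=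
    fun s' => (bump_lip x _).continuous.mul (by fun_prop)
  have hmeas : MeasurableSet (annulus3 x (2 * (t - s))) := (annulus3_compact x _).measurableSet
  refine (hasDerivAt_integral_of_dominated_loc_of_lip (𝕜 := ℝ) (μ := volume)
    (F := fun s y => psiCutoff (‖y - x‖ - 2 * (t - s)) * q (s, y))
    (bound := (Metric.closedBall x R).indicator fun _ => M' + 2 * M)
    (Icc_mem_nhds (by linarith : s - 1 < s) (by linarith : s < s + 1)) ?_ ?_ ?_ ?_ ?_ ?_).2
  · exact Filter.Eventually.of_forall fun s' => (hcs s').aestronglyMeasurable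
  · exact (hcs s).integrable_of_hasCompactSupport (bump_cpt x _).mul_right
  · apply AEStronglyMeasurable.add
    · exact (by fun_prop : Continuous fun y => -2 * q (s, y)).aestronglyMeasurable.indicator hmeas
    · exact ((bump_lip x _).continuous.mul
        (hcq'.comp (by fun_prop : Continuous fun y : E3 => (s, y)))).aestronglyMeasurable
  · refine Filter.Eventually.of_forall fun y => ?_
    by_cases hy : y ∈ Metric.closedBall x R
    · apply LipschitzOnWith.of_dist_le_mul
      intro a ha b hb
      rw [Set.indicator_of_mem hy, Real.coe_nnabs, Real.dist_eq, Real.dist_eq]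
      have h1 : |q (a, y) - q (b, y)| ≤ M' * |a - b| := by
        have := (convex_Icc (s - 1) (s + 1)).norm_image_sub_le_of_norm_hasDerivWithin_le
          (f := fun τ => q (τ, y)) (f' := fun τ => fderiv ℝ q (τ, y) (1, 0)) (C := M')
          (fun τ _ => (hd τ y).hasDerivWithinAt) (fun τ hτ => hM' (τ, y) ⟨hτ, hy⟩) hb ha
        simpa [Real.norm_eq_abs] using this
      have h2 : |q (b, y)| ≤ M := hM (b, y) ⟨hb, hy⟩
      have h3 : |psiCutoff (‖y - x‖ - 2 * (t - a)) - psiCutoff (‖y - x‖ - 2 * (t - b))|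
          ≤ 2 * |a - b| := by
        refine (psiCutoff_abs_sub _ _).trans (le_of_eq ?_)
        rw [show ‖y - x‖ - 2 * (t - a) - (‖y - x‖ - 2 * (t - b)) = 2 * (a - b) by ring,
          abs_mul, abs_two]
      have h4 : |psiCutoff (‖y - x‖ - 2 * (t - a))| ≤ 1 := by
        rw [abs_of_nonneg (psiCutoff_nonneg _)]; exact psiCutoff_le_one _
      calc _ = |psiCutoff (‖y - x‖ - 2 * (t - a)) * (q (a, y) - q (b, y))
              + (psiCutoff (‖y - x‖ - 2 * (t - a)) - psiCutoff (‖y - x‖ - 2 * (t - b)))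
                * q (b, y)| := by ring_nf
        _ ≤ 1 * (M' * |a - b|) + (2 * |a - b|) * M := by
            refine (abs_add_le _ _).trans ?_
            rw [abs_mul, abs_mul]
            gcongr
        _ = (M' + 2 * M) * |a - b| := by ring
        _ ≤ |M' + 2 * M| * |a - b| := by gcongr; exact le_abs_self _
    · rw [Metric.mem_closedBall, dist_eq_norm, not_le] at hy
      have hz : ∀ a ∈ Set.Icc (s - 1) (s + 1),
          psiCutoff (‖y - x‖ - 2 * (t - a)) * q (a, y) = 0 := by
        intro a ha
        rw [psiCutoff_zero (by linarith [ha.1]), zero_mul]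
      apply LipschitzOnWith.of_dist_le_mul
      intro a ha b hb
      simp only [hz a ha, hz b hb, dist_self]
      positivity
  · exact (integrable_indicator_iff measurableSet_closedBall).2
      (integrableOn_const (isCompact_closedBall x R).measure_lt_top.ne)
  · filter_upwards [sphere_ae x (2 * (t - s)), sphere_ae x (2 * (t - s) + 1)] with y h0 h1
    have hin : HasDerivAt (fun τ => ‖y - x‖ - 2 * (t - τ)) 2 s := by
      have := (((hasDerivAt_id s).const_sub t).const_mul 2).const_sub ‖y - x‖
      simpa using this
    have hp := (psiCutoff_hasDerivAt (r := ‖y - x‖ - 2 * (t - s))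
      (fun h => h0 (by linarith)) (fun h => h1 (by linarith))).comp s hin
    refine (hp.mul (hd s y)).congr_deriv ?_
    by_cases hy : y ∈ annulus3 x (2 * (t - s))
    · rw [Set.indicator_of_mem hy, Set.indicator_of_mem (show _ ∈ Set.Icc (0:ℝ) 1 from hy)]
      simp only [Function.comp]; ring
    · rw [Set.indicator_of_notMem hy, Set.indicator_of_notMem (show _ ∉ Set.Icc (0:ℝ) 1 from hy)]
      simp only [Function.comp]; ring

lemma slice_time (g : ℝ × E3 → ℝ) (hg : Differentiable ℝ g) (s : ℝ) (y : E3) :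
    HasDerivAt (fun τ => g (τ, y)) (fderiv ℝ g (s, y) (1, 0)) s :=
  (hg (s, y)).hasFDerivAt.comp_hasDerivAt s ((hasDerivAt_id s).prodMk (hasDerivAt_const s y))

lemma slice_space (g : ℝ × E3 → ℝ) (hg : Differentiable ℝ g) (s : ℝ) (y e : E3) :
    fderiv ℝ (fun z => g (s, z)) y e = fderiv ℝ g (s, y) (0, e) := by
  have h : HasFDerivAt (fun z => g (s, z))
      ((fderiv ℝ g (s, y)).comp (ContinuousLinearMap.inr ℝ ℝ E3)) y :=
    (hg (s, y)).hasFDerivAt.comp y (hasFDerivAt_prodMk_right s y)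
  rw [h.fderiv]
  simp

theorem tartar_energy_derivative_bound
    (v : ℝ → EuclideanSpace ℝ (Fin 3) → ℝ)
    (hsmooth : ContDiff ℝ (⊤ : ℕ∞) (Function.uncurry v))
    (hwave : ∀ s : ℝ, 0 ≤ s → ∀ y,
      deriv (deriv (fun τ => v τ y)) s = laplacian3 (v s) y)
    (K : ℝ) (hK : 1 ≤ K)
    (t : ℝ) (ht : 0 ≤ t) (x : EuclideanSpace ℝ (Fin 3)) :
    ∀ᵐ s : ℝ, s ∈ Set.Icc (0 : ℝ) t →
      deriv (tartarEnergy v x t K) s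
        ≤ - (K / 2) * (∫ y in {y : EuclideanSpace ℝ (Fin 3) |
              ‖y - x‖ - 2 * (t - s) ∈ Set.Icc (0 : ℝ) 1}, (v s y) ^ 2)
          + K * tartarEnergy v x t K s := by
  refine Filter.Eventually.of_forall fun s hs => ?_
  set u : ℝ × E3 → ℝ := Function.uncurry v with hu
  set D : ℝ × E3 → ℝ × E3 → ℝ := fun a z => fderiv ℝ u z a with hDdef
  have h2inf : (2 : WithTop ℕ∞) ≤ ((⊤ : ℕ∞) : WithTop ℕ∞) := WithTop.coe_le_coe.2 le_top
  have h11inf : (1 + 1 : WithTop ℕ∞) ≤ ((⊤ : ℕ∞) : WithTop ℕ∞) := by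
    rw [one_add_one_eq_two]; exact h2inf
  have hu1 : ContDiff ℝ 1 u := hsmooth.of_le (by exact_mod_cast le_top)
  have hud : Differentiable ℝ u := hu1.differentiable (by simp)
  have hD : ∀ a, ContDiff ℝ 1 (D a) := by
    intro a
    have : ContDiff ℝ 1 (fderiv ℝ u) :=
      hsmooth.fderiv_right h11inf
    exact this.clm_apply contDiff_const
  have hDd : ∀ a, Differentiable ℝ (D a) := fun a => (hD a).differentiable (by simp)
  have hsym : ∀ a b z, fderiv ℝ (D a) z b = fderiv ℝ (D b) z a := by
    intro a b z
    have h2 : IsSymmSndFDerivAt ℝ u z :=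
      (hsmooth.contDiffAt (x := z)).isSymmSndFDerivAt
        (by simpa only [minSmoothness_of_isRCLikeNormedField] using h2inf)
    have hfd : DifferentiableAt ℝ (fderiv ℝ u) z :=
      ((hsmooth.fderiv_right (m := 1) h11inf).differentiable (by simp)) z
    have h3 : ∀ a b, fderiv ℝ (D a) z b = fderiv ℝ (fderiv ℝ u) z b a := by
      intro a b
      have h4 := (hfd.hasFDerivAt.clm_apply (hasFDerivAt_const a z)).fderiv
      change fderiv ℝ (fun z => fderiv ℝ u z a) z b = _
      rw [h4]
      simp
    rw [h3, h3]
    exact h2 b a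
  have hw : ∀ s y, deriv (fun τ => v τ y) s = D (1, 0) (s, y) :=
    fun s y => (slice_time u hud s y).deriv
  have hp : ∀ s y e, fderiv ℝ (v s) y e = D (0, e) (s, y) :=
    fun s y e => slice_space u hud s y e
  let e : Fin 3 → E3 := fun i => EuclideanSpace.single i 1
  have hwv : ∀ y, fderiv ℝ (D (1, 0)) (s, y) (1, 0)
      = ∑ i, fderiv ℝ (D (0, e i)) (s, y) (0, e i) := by
    intro y
    have h := hwave s hs.1 y
    rw [show deriv (fun τ => v τ y) = fun s => D (1, 0) (s, y) from funext fun s => hw s y,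
      (slice_time _ (hDd (1, 0)) s y).deriv] at h
    rw [h]
    unfold laplacian3
    refine Finset.sum_congr rfl fun i _ => ?_
    simp_rw [hp]
    exact slice_space _ (hDd _) s y _
  set q : ℝ × E3 → ℝ := fun z => D (1, 0) z ^ 2 + ∑ i, D (0, e i) z ^ 2 + K * u z ^ 2 with hqdef
  have hq : ContDiff ℝ 1 q := by
    refine (((hD _).pow 2).add (ContDiff.sum fun i _ => (hD _).pow 2)).add
      (contDiff_const.mul (hu1.pow 2))
  have hE : tartarEnergy v x t K
      = fun s => (1 / 2 : ℝ) * ∫ y, psiCutoff (‖y - x‖ - 2 * (t - s)) * q (s, y) := by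
    funext s
    unfold tartarEnergy
    simp_rw [norm_sq_dual, hw, hp]
    rfl
  set c : ℝ := 2 * (t - s) with hc
  let h : Fin 3 → E3 → ℝ := fun i y => D (1, 0) (s, y) * D (0, e i) (s, y)
  have hsl : ∀ g : ℝ × E3 → ℝ, ContDiff ℝ 1 g → ContDiff ℝ 1 fun y : E3 => g (s, y) :=
    fun g hg => hg.comp (contDiff_const.prodMk contDiff_id)
  have hh : ∀ i, ContDiff ℝ 1 (h i) := fun i => (hsl _ (hD _)).mul (hsl _ (hD _))
  have hhd : ∀ i y, fderiv ℝ (h i) y (e i)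
      = fderiv ℝ (D (0, e i)) (s, y) (1, 0) * D (0, e i) (s, y)
        + D (1, 0) (s, y) * fderiv ℝ (D (0, e i)) (s, y) (0, e i) := by
    intro i y
    have h1 := slice_space (fun z => D (1, 0) z * D (0, e i) z) ((hDd _).mul (hDd _)) s y (e i)
    change fderiv ℝ (h i) y (e i) = _ at h1
    rw [h1, fderiv_fun_mul (hDd _ _) (hDd _ _), hsym (0, e i) (1, 0)]
    simp
    ring
  have hqd : ∀ y, fderiv ℝ q (s, y) (1, 0)
      = 2 * ∑ i, fderiv ℝ (h i) y (e i) + 2 * K * (u (s, y) * D (1, 0) (s, y)) := by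
    intro y
    have h1 := slice_time q (hq.differentiable (by simp)) s y
    have h2 : HasDerivAt (fun τ => q (τ, y)) _ s :=
      (((slice_time _ (hDd (1, 0)) s y).pow 2).add
        (HasDerivAt.fun_sum (u := Finset.univ)
          fun i _ => (slice_time _ (hDd (0, e i)) s y).fun_pow 2)).add
        (((slice_time u hud s y).fun_pow 2).const_mul K)
    rw [h1.unique h2, hwv]
    simp_rw [hhd]
    have h3 : fderiv ℝ u (s, y) (1, 0) = D (1, 0) (s, y) := rfl
    rw [h3]
    simp only [Fin.sum_univ_three]
    push_cast
    ring
  -- continuity and integrability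
  have hcs : ∀ g : ℝ × E3 → ℝ, ContDiff ℝ 1 g → Continuous fun y : E3 => g (s, y) :=
    fun g hg => (hsl g hg).continuous
  have intφ : ∀ g : E3 → ℝ, Continuous g → Integrable fun y => psiCutoff (‖y - x‖ - c) * g y :=
    fun g hg => ((bump_lip x c).continuous.mul hg).integrable_of_hasCompactSupport
      (bump_cpt x c).mul_right
  have hAm : MeasurableSet (annulus3 x c) := (annulus3_compact x c).measurableSet
  have intA : ∀ g : E3 → ℝ, Continuous g → Integrable ((annulus3 x c).indicator g) :=
    fun g hg => (integrable_indicator_iff hAm).2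
      (hg.continuousOn.integrableOn_compact (annulus3_compact x c))
  have hq0 : Continuous fun y => q (s, y) := hcs q hq
  have hu0 : Continuous fun y => u (s, y) := hcs u hu1
  have hw0 : Continuous fun y => D (1, 0) (s, y) := hcs _ (hD _)
  have hibp := fun i => bump_ibp x c (e i) (h i) (hh i)
  have hfd0 : ∀ i, Continuous fun y => fderiv ℝ (h i) y (e i) :=
    fun i => ((hh i).continuous_fderiv (by simp)).clm_apply continuous_const
  let l : Fin 3 → E3 → ℝ := fun i y =>
    lineDeriv ℝ (fun y : E3 => psiCutoff (‖y - x‖ - c)) y (e i)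
  have hl : ∀ i, Integrable fun y => l i y * h i y := fun i => (hibp i).1
  have hder : deriv (tartarEnergy v x t K) s
      = ∫ y, ((annulus3 x c).indicator (fun y => - q (s, y)) y
          + ((- ∑ i, l i y * h i y) + K * (psiCutoff (‖y - x‖ - c) *
            (u (s, y) * D (1, 0) (s, y))))) := by
    rw [hE, ((bump_hasDerivAt q hq x t s).const_mul (1 / 2 : ℝ)).deriv]
    simp_rw [hqd]
    rw [← hc]
    have i1 := intA (fun y => -2 * q (s, y)) (continuous_const.mul hq0)
    have i1' := intA (fun y => - q (s, y)) hq0.neg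
    have i2 : Integrable fun y => psiCutoff (‖y - x‖ - c) *
        (2 * ∑ i, fderiv ℝ (h i) y (e i) + 2 * K * (u (s, y) * D (1, 0) (s, y))) :=
      intφ _ ((continuous_const.mul (continuous_finsetSum _ fun i _ => hfd0 i)).add
        (continuous_const.mul (hu0.mul hw0)))
    have i3 : Integrable fun y => ∑ i, l i y * h i y := integrable_finsetSum _ fun i _ => hl i
    have i4 := (intφ (fun y => u (s, y) * D (1, 0) (s, y)) (hu0.mul hw0)).const_mul K
    have i3' : Integrable fun y => - ∑ i, l i y * h i y := i3.neg
    have i5 : Integrable fun y => (- ∑ i, l i y * h i y) + K * (psiCutoff (‖y - x‖ - c) *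
        (u (s, y) * D (1, 0) (s, y))) := i3'.add i4
    have e1 : ∫ y, psiCutoff (‖y - x‖ - c) *
        (2 * ∑ i, fderiv ℝ (h i) y (e i) + 2 * K * (u (s, y) * D (1, 0) (s, y)))
        = 2 * (∑ i, ∫ y, psiCutoff (‖y - x‖ - c) * fderiv ℝ (h i) y (e i))
          + 2 * ∫ y, K * (psiCutoff (‖y - x‖ - c) * (u (s, y) * D (1, 0) (s, y))) := by
      rw [← integral_finsetSum _ fun i _ => intφ _ (hfd0 i), ← integral_const_mul,
        ← integral_const_mul, ← integral_add]
      · congr 1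
        funext y
        rw [← Finset.mul_sum]
        ring
      · exact (integrable_finsetSum _ fun i _ => intφ _ (hfd0 i)).const_mul 2
      · exact i4.const_mul 2
    have e2 : ∫ y, ∑ i, l i y * h i y
        = - ∑ i, ∫ y, psiCutoff (‖y - x‖ - c) * fderiv ℝ (h i) y (e i) := by
      rw [integral_finsetSum _ fun i _ => hl i, ← Finset.sum_neg_distrib]
      refine Finset.sum_congr rfl fun i _ => ?_
      rw [(hibp i).2, neg_neg]
    have e3 : ∫ y, (annulus3 x c).indicator (fun y => -2 * q (s, y)) y
        = 2 * ∫ y, (annulus3 x c).indicator (fun y => - q (s, y)) y := by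
      rw [← integral_const_mul]
      congr 1
      funext y
      by_cases hy : y ∈ annulus3 x c
      · simp [hy]
      · simp [hy]
    rw [integral_add i1 i2, integral_add i1' i5, integral_add i3' i4,
      e1, e3, integral_neg, e2]
    ring
  have hrhs : - (K / 2) * (∫ y in {y : EuclideanSpace ℝ (Fin 3) |
              ‖y - x‖ - c ∈ Set.Icc (0 : ℝ) 1}, (v s y) ^ 2)
          + K * tartarEnergy v x t K s
      = ∫ y, (-(K / 2) * (annulus3 x c).indicator (fun y => u (s, y) ^ 2) y
          + (K / 2) * (psiCutoff (‖y - x‖ - c) * q (s, y))) := by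
    rw [integral_add ((intA (fun y => u (s, y) ^ 2) (hu0.pow 2)).const_mul _) ((intφ _ hq0).const_mul _),
      integral_const_mul, integral_const_mul, integral_indicator hAm, hE]
    have : ∫ y in annulus3 x c, u (s, y) ^ 2 = ∫ y in {y : EuclideanSpace ℝ (Fin 3) |
              ‖y - x‖ - c ∈ Set.Icc (0 : ℝ) 1}, (v s y) ^ 2 := rfl
    rw [this]
    ring
  rw [hder, hrhs]
  refine integral_mono_ae ?_ ?_ ?_
  · exact (intA _ hq0.neg).add ((integrable_finsetSum _ fun i _ => hl i).neg.add
      ((intφ _ (hu0.mul hw0)).const_mul K))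
  · exact ((intA _ (hu0.pow 2)).const_mul _).add ((intφ _ hq0).const_mul _)
  filter_upwards [(bump_lip x c).ae_differentiableAt] with y hy
  have hφ0 := psiCutoff_nonneg (‖y - x‖ - c)
  have hP : 0 ≤ ∑ i, D (0, e i) (s, y) ^ 2 := Finset.sum_nonneg fun i _ => sq_nonneg _
  have hmain : K * (psiCutoff (‖y - x‖ - c) * (u (s, y) * D (1, 0) (s, y)))
      ≤ (K / 2) * (psiCutoff (‖y - x‖ - c) * q (s, y)) := by
    have h1 : u (s, y) * D (1, 0) (s, y) ≤ (1 / 2) * q (s, y) := by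
      simp only [hqdef]
      nlinarith [sq_nonneg (u (s, y) - D (1, 0) (s, y)), sq_nonneg (u (s, y))]
    calc _ ≤ K * (psiCutoff (‖y - x‖ - c) * ((1 / 2) * q (s, y))) := by gcongr
      _ = _ := by ring
  by_cases hyA : y ∈ annulus3 x c
  · simp only [Set.indicator_of_mem hyA]
    have hn : ∑ i, l i y ^ 2 ≤ 1 := by
      have h1 := norm_sq_dual (fderiv ℝ (fun y : E3 => psiCutoff (‖y - x‖ - c)) y)
      have h2 : ‖fderiv ℝ (fun y : E3 => psiCutoff (‖y - x‖ - c)) y‖ ≤ 1 := by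
        simpa using norm_fderiv_le_of_lipschitz ℝ (bump_lip x c) (x₀ := y)
      have h3 : ∀ i, l i y = fderiv ℝ (fun y : E3 => psiCutoff (‖y - x‖ - c)) y (e i) :=
        fun i => hy.lineDeriv_eq_fderiv
      simp_rw [h3]
      rw [← h1]
      nlinarith [norm_nonneg (fderiv ℝ (fun y : E3 => psiCutoff (‖y - x‖ - c)) y)]
    have hcs : - ∑ i, l i y * h i y
        ≤ (1 / 2) * (D (1, 0) (s, y) ^ 2 + ∑ i, D (0, e i) (s, y) ^ 2) := by
      have h1 : - ∑ i, l i y * h i y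
          ≤ (1 / 2) * (D (1, 0) (s, y) ^ 2 * ∑ i, l i y ^ 2 + ∑ i, D (0, e i) (s, y) ^ 2) := by
        rw [Finset.mul_sum, ← Finset.sum_add_distrib, Finset.mul_sum, ← Finset.sum_neg_distrib]
        refine Finset.sum_le_sum fun i _ => ?_
        simp only [h]
        nlinarith [sq_nonneg (D (1, 0) (s, y) * l i y + D (0, e i) (s, y))]
      nlinarith [mul_le_mul_of_nonneg_left hn (sq_nonneg (D (1, 0) (s, y)))]
    have hqe : q (s, y)
      = D (1, 0) (s, y) ^ 2 + ∑ i, D (0, e i) (s, y) ^ 2 + K * u (s, y) ^ 2 := rfl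
    have hKu : 0 ≤ K * u (s, y) ^ 2 := by positivity
    nlinarith [sq_nonneg (D (1, 0) (s, y))]
  · simp only [Set.indicator_of_notMem hyA]
    have : ∑ i, l i y * h i y = 0 :=
      Finset.sum_eq_zero fun i _ => by
        simp only [l]; rw [bump_lineDeriv_off x c (e i) hyA, zero_mul]
    rw [this]
    linarith
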